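/- arXiv:math-ph/0010036 — 2 statements merged into one kernel-verified Lean document; each statement's English description precedes it below -/
import Mathlib

section
/- (Proposition 2b) For 1 ≤ p < n, a ∈ 𝔓^{n−1}M and b ∈ 𝔓^{p−1}M: {a, ^s b}_s = −(^s(db))·Ξ(a)(τ) + ^s{a,b}, where {a,b} = Ξ(a)⌟db is the external 𝔭-bracket and Ξ(a)(τ) := Σ_α dx^α(Ξ(a)) τ_α. Consequently, if dx^α(Ξ(a)) = 0 for all α, then the internal 𝔭-bracket {a,b} exists and coincides with the external 𝔭-bracket Ξ(a)⌟db. -/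
open scoped BigOperators
open MeasureTheory

noncomputable section

namespace Pataplectic

/-- A multi-index `μ : Fin d → Fin e` is increasing. -/
def IncP {d e : ℕ} (μ : Fin d → Fin e) : Prop := ∀ a b : Fin d, a < b → μ a < μ b

instance {d e : ℕ} : DecidablePred (@IncP d e) := fun μ => by unfold IncP; infer_instance

variable (n k : ℕ)

/-- Coordinates on `X × Y`, where `X = ℝⁿ` and `Y = ℝᵏ`. -/
abbrev E := Fin (n + k) → ℝ

/-- Increasing multi-indices of length `n`, indexing the coordinates
`p_{μ₁…μₙ}` of a point of `ΛⁿT*(X×Y)` over a point of `X×Y`. -/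
abbrev Idx := {μ : Fin n → Fin (n + k) // IncP μ}

/-- The fiber of `ΛⁿT*(X×Y)`, described by its coordinates `p_{μ₁…μₙ}`. -/
abbrev Psp := Idx n k → ℝ

/-- The pataplectic manifold `M = ΛⁿT*(X×Y)`. -/
abbrev Mfd := E n k × Psp n k

/-- Evaluation `⟨p, z₁ ∧ … ∧ zₙ⟩` of `p ∈ ΛⁿT*_q(X×Y)` on an `n`-tuple of
tangent vectors: `Σ_{μ₁<…<μₙ} p_{μ₁…μₙ} det (z_b^{μ_a})`. -/
def pApply (p : Psp n k) (z : Fin n → E n k) : ℝ :=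
  ∑ μ : Idx n k, p μ * Matrix.det (Matrix.of fun a b => z b (μ.1 a))

/-- A (raw) differential `d`-form on `M`, given by its evaluation on `d`-tuples
of tangent vectors. -/
abbrev Form (d : ℕ) := Mfd n k → (Fin d → Mfd n k) → ℝ

variable {n k}

/-- The exterior derivative of a `d`-form on `M`, via the standard formula
on constant vector fields. -/
def extD {d : ℕ} (ω : Form n k d) : Form n k (d + 1) :=
  fun x v => ∑ i : Fin (d + 1),
    (-1 : ℝ) ^ (i : ℕ) * fderiv ℝ (fun y => ω y (i.removeNth v)) x (v i)

/-- Interior product of a vector field with a `(d+1)`-form. -/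
def iota {d : ℕ} (ξ : Mfd n k → Mfd n k) (ω : Form n k (d + 1)) : Form n k d :=
  fun x v => ω x (Fin.cons (ξ x) v)

/-- A raw form is smooth if its evaluation on any fixed tuple of (constant)
tangent vectors is a smooth function on `M`. -/
def SmoothF {d : ℕ} (ω : Form n k d) : Prop := ∀ v, ContDiff ℝ (⊤ : ℕ∞) (fun x => ω x v)

variable (n k)

/-- The Poincaré–Cartan form `θ = Σ_{μ₁<…<μₙ} p_{μ₁…μₙ} dq^{μ₁}∧…∧dq^{μₙ}`. -/
def theta : Form n k n := fun m v => pApply n k m.2 (fun i => (v i).1)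

/-- The pataplectic form `Ω = dθ`. -/
def Omega : Form n k (n + 1) := extD (theta n k)

/-- The volume form `ω = dx¹∧…∧dxⁿ`, pulled back to `M`. -/
def vol : Form n k n := fun _ v => Matrix.det (Matrix.of fun a b => (v b).1 (Fin.castAdd k a))

/-- Lie bracket of two vector fields on `M`. -/
def lieB {n k : ℕ} (ξ η : Mfd n k → Mfd n k) : Mfd n k → Mfd n k :=
  fun x => fderiv ℝ η x (ξ x) - fderiv ℝ ξ x (η x)


/-- The wedge product `dx^{α₁} ∧ … ∧ dx^{α_m} ∧ a` of coordinate 1-forms of `X`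
with a raw `l`-form `a` on `M`, via the standard alternation formula. -/
def wedgeDxR {n k : ℕ} (l m : ℕ) (α : Fin m → Fin n) (a : Form n k l) :
    Form n k (m + l) :=
  fun x v => (((m.factorial * l.factorial : ℕ) : ℝ))⁻¹ *
    ∑ σ : Equiv.Perm (Fin (m + l)),
      ((Equiv.Perm.sign σ : ℤ) : ℝ) *
        Matrix.det (Matrix.of fun (i j : Fin m) =>
          (v (σ (Fin.castAdd l j))).1 (Fin.castAdd k (α i))) *
        a x (fun j : Fin l => v (σ (Fin.natAdd m j)))

/-- The Grassmann algebra generated by `τ₁,…,τₙ`. -/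
abbrev Gr (n : ℕ) := ExteriorAlgebra ℝ (Fin n → ℝ)

/-- The Grassmann monomial `τ_{α₁} ⋯ τ_{α_m}`. -/
def tauMon {n : ℕ} {m : ℕ} (α : Fin m → Fin n) : Gr n :=
  (List.ofFn fun i => ExteriorAlgebra.ι ℝ (Pi.single (α i) (1 : ℝ))).prod

/-- The super-function `Ξ(a)(τ) = Σ_α dx^α(Ξ(a)) τ_α`. -/
def XiTau {n k : ℕ} (Xia : Mfd n k → Mfd n k) (x : Mfd n k) : Gr n :=
  ∑ α : Fin n, ((Xia x).1 (Fin.castAdd k α)) • ExteriorAlgebra.ι ℝ (Pi.single α (1 : ℝ))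

section
open AlternatingMap

section Alg
variable {V : Type*} [AddCommGroup V] [Module ℝ V]

/-- Wedge product with one covector on the left. -/
def wd1 {N : ℕ} (φ : V →ₗ[ℝ] ℝ) : (V [⋀^Fin N]→ₗ[ℝ] ℝ) →ₗ[ℝ] (V [⋀^Fin (N + 1)]→ₗ[ℝ] ℝ) where
  toFun A := alternatizeUncurryFin (φ.smulRight A)
  map_add' A B := by
    ext v
    simp [alternatizeUncurryFin_apply, Finset.sum_add_distrib]
  map_smul' c A := by
    ext v
    simp only [alternatizeUncurryFin_apply, LinearMap.smulRight_apply, AlternatingMap.smul_apply,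
      RingHom.id_apply, Finset.smul_sum]
    refine Finset.sum_congr rfl fun i _ => ?_
    rw [smul_comm c, smul_comm c]

theorem wd1_eq {N : ℕ} (φ : V →ₗ[ℝ] ℝ) (A : V [⋀^Fin N]→ₗ[ℝ] ℝ) :
    wd1 φ A = alternatizeUncurryFin (φ.smulRight A) := rfl

theorem wd1_apply {N : ℕ} (φ : V →ₗ[ℝ] ℝ) (A : V [⋀^Fin N]→ₗ[ℝ] ℝ) (v : Fin (N + 1) → V) :
    wd1 φ A v = ∑ i : Fin (N + 1), (-1 : ℝ) ^ (i : ℕ) * (φ (v i) * A (i.removeNth v)) := by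
  rw [wd1_eq, alternatizeUncurryFin_apply]
  refine Finset.sum_congr rfl fun i _ => ?_
  rcases neg_one_pow_eq_or ℤ (i : ℕ) with h | h <;>
  rcases neg_one_pow_eq_or ℝ (i : ℕ) with h' | h' <;>
  rcases Nat.even_or_odd (i : ℕ) with h'' | h'' <;>
  simp [h''.neg_one_pow]

theorem altsum_apply {N : ℕ} {ι : Type*} (s : Finset ι) (f : ι → V [⋀^Fin N]→ₗ[ℝ] ℝ)
    (v : Fin N → V) : (∑ i ∈ s, f i) v = ∑ i ∈ s, f i v := by
  classical
  induction s using Finset.induction_on with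
  | empty => simp
  | insert i s hi ih => rw [Finset.sum_insert hi, Finset.sum_insert hi, AlternatingMap.add_apply, ih]

/-- Iterated wedge product with covectors. -/
def wd {l : ℕ} : (m : ℕ) → (Fin m → V →ₗ[ℝ] ℝ) →
    ((V [⋀^Fin l]→ₗ[ℝ] ℝ) →ₗ[ℝ] (V [⋀^Fin (l + m)]→ₗ[ℝ] ℝ))
  | 0, _ => LinearMap.id
  | m + 1, φ => wd1 (φ 0) ∘ₗ wd m (Fin.tail φ)

theorem wd_zero {l : ℕ} (φ : Fin 0 → V →ₗ[ℝ] ℝ) (A : V [⋀^Fin l]→ₗ[ℝ] ℝ) : wd 0 φ A = A := rfl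

theorem wd_succ {l m : ℕ} (φ : Fin (m + 1) → V →ₗ[ℝ] ℝ) (A : V [⋀^Fin l]→ₗ[ℝ] ℝ) :
    wd (m + 1) φ A = wd1 (φ 0) (wd m (Fin.tail φ) A) := rfl

theorem alt_wd1 {N : ℕ} (φ : V →ₗ[ℝ] ℝ) (B : V →ₗ[ℝ] V [⋀^Fin N]→ₗ[ℝ] ℝ) :
    alternatizeUncurryFin (wd1 φ ∘ₗ B) = - wd1 φ (alternatizeUncurryFin B) := by
  have key := alternatizeUncurryFin_alternatizeUncurryFinLM_comp_of_symmetric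
    (f := (φ.smulRight B) + (φ.smulRight B).flip) (by
      intro x y
      simp only [LinearMap.add_apply, LinearMap.flip_apply]
      rw [add_comm])
  have e : alternatizeUncurryFinLM ∘ₗ ((φ.smulRight B) + (φ.smulRight B).flip)
      = φ.smulRight (alternatizeUncurryFin B) + wd1 φ ∘ₗ B := by
    ext u v
    simp only [LinearMap.comp_apply, LinearMap.add_apply, map_add, wd1_eq,
      LinearMap.smulRight_apply, map_smul, alternatizeUncurryFinLM_apply,
      AlternatingMap.add_apply]
    congr 2
  rw [e, alternatizeUncurryFin_add] at key
  rw [wd1_eq]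
  exact eq_neg_of_add_eq_zero_right key

theorem wd1_cast {N N' : ℕ} (h : N = N') (φ : V →ₗ[ℝ] ℝ) (A : V [⋀^Fin N]→ₗ[ℝ] ℝ)
    (A' : V [⋀^Fin N']→ₗ[ℝ] ℝ) (hA : ∀ v, A v = A' (fun j => v (Fin.cast h.symm j)))
    (v : Fin (N + 1) → V) :
    wd1 φ A v = wd1 φ A' (fun j => v (Fin.cast (by rw [h]) j)) := by
  subst h
  have : A = A' := by ext v; exact hA v
  rw [this]; rfl

/-- `d (φ₁ ∧ … ∧ φ_m ∧ b) = (-1)^m φ₁ ∧ … ∧ φ_m ∧ db`, algebraic form. -/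
theorem alt_wd {l : ℕ} (m : ℕ) (φ : Fin m → V →ₗ[ℝ] ℝ) (B : V →ₗ[ℝ] V [⋀^Fin l]→ₗ[ℝ] ℝ)
    (v : Fin (l + m + 1) → V) :
    alternatizeUncurryFin (wd m φ ∘ₗ B) v
      = (-1) ^ m * wd m φ (alternatizeUncurryFin B) (fun j => v (Fin.cast (by omega) j)) := by
  induction m with
  | zero => simp only [pow_zero, one_mul]; rfl
  | succ m ih =>
    have e : wd (m + 1) φ ∘ₗ B = wd1 (φ 0) ∘ₗ (wd m (Fin.tail φ) ∘ₗ B) := rfl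
    have h2 := wd1_cast (show l + m + 1 = l + 1 + m by omega) (φ 0)
      (alternatizeUncurryFin (wd m (Fin.tail φ) ∘ₗ B))
      ((-1 : ℝ) ^ m • wd m (Fin.tail φ) (alternatizeUncurryFin B))
      (fun v => by rw [ih]; rfl) v
    rw [e, alt_wd1, AlternatingMap.neg_apply, wd_succ]
    refine (congrArg Neg.neg h2).trans ?_
    rw [map_smul, AlternatingMap.smul_apply, smul_eq_mul, pow_succ]
    have h3 : ∀ p q : ℝ, -(p * q) = p * -1 * q := fun p q => by ring
    exact h3 _ _

theorem wd1_cons {N : ℕ} (φ : V →ₗ[ℝ] ℝ) (A : V [⋀^Fin (N + 1)]→ₗ[ℝ] ℝ) (ξ : V)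
    (v : Fin (N + 1) → V) :
    wd1 φ A (Fin.cons ξ v) = φ ξ * A v - wd1 φ (A.curryLeft ξ) v := by
  rw [wd1_apply, wd1_apply, Fin.sum_univ_succ, sub_eq_add_neg, ← Finset.sum_neg_distrib]
  congr 1
  · simp
  · refine Finset.sum_congr rfl fun i _ => ?_
    have : (i.succ.removeNth (Fin.cons ξ v : Fin (N + 2) → V)) = Fin.cons ξ (i.removeNth v) := by
      ext j
      refine Fin.cases ?_ (fun j => ?_) j <;> simp [Fin.removeNth]
    rw [this]
    simp only [Fin.cons_succ, Fin.val_succ, pow_succ, AlternatingMap.curryLeft_apply_apply]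
    simp only [Matrix.vecCons]
    ring

/-- Interior product of an iterated wedge. -/
theorem wd_cons {l : ℕ} (m : ℕ) (φ : Fin (m + 1) → V →ₗ[ℝ] ℝ) (A : V [⋀^Fin (l + 1)]→ₗ[ℝ] ℝ)
    (ξ : V) (v : Fin (l + 1 + m) → V) :
    wd (m + 1) φ A (Fin.cons ξ v)
      = ∑ i : Fin (m + 1), (-1 : ℝ) ^ (i : ℕ) * (φ i ξ * wd m (i.removeNth φ) A v)
        + (-1) ^ (m + 1) * wd (m + 1) φ (A.curryLeft ξ) (fun j => v (Fin.cast (by omega) j)) := by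
  induction m with
  | zero =>
    rw [wd_succ, wd_succ]
    refine (wd1_cons (φ 0) A ξ v).trans ?_
    have hs : ∀ f : Fin (0 + 1) → ℝ, ∑ i, f i = f 0 := fun f => Fin.sum_univ_one f
    rw [hs]
    simp only [Fin.val_zero, pow_zero, one_mul, zero_add, pow_one, sub_eq_add_neg, neg_mul]
    rfl
  | succ m ih =>
    rw [wd_succ]
    refine (wd1_cons (φ 0) (wd (m + 1) (Fin.tail φ) A) ξ v).trans ?_
    have h2 := wd1_cast (show l + 1 + m = l + (m + 1) by omega) (φ 0)
      ((wd (m + 1) (Fin.tail φ) A).curryLeft ξ - ∑ i : Fin (m + 1), ((-1 : ℝ) ^ (i : ℕ) *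
          Fin.tail φ i ξ) • wd m (i.removeNth (Fin.tail φ)) A)
      ((-1 : ℝ) ^ (m + 1) • wd (m + 1) (Fin.tail φ) (A.curryLeft ξ))
      (fun w => by
        have := ih (Fin.tail φ) w
        rw [AlternatingMap.sub_apply, AlternatingMap.curryLeft_apply_apply]
        refine (congrArg (· - _) this).trans ?_
        rw [altsum_apply]
        simp only [AlternatingMap.smul_apply, smul_eq_mul, mul_assoc]
        exact add_sub_cancel_left _ _) v
    rw [map_sub, AlternatingMap.sub_apply, map_sum, altsum_apply, map_smul,
      AlternatingMap.smul_apply, smul_eq_mul] at h2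
    simp only [map_smul, AlternatingMap.smul_apply, smul_eq_mul] at h2
    have h3 : ∀ i : Fin (m + 1), wd (m + 1) (i.succ.removeNth φ) A v
        = wd1 (φ 0) (wd m (i.removeNth (Fin.tail φ)) A) v := by
      intro i
      rw [wd_succ]
      have e1 : i.succ.removeNth φ 0 = φ 0 := by simp [Fin.removeNth]
      have e2 : Fin.tail (i.succ.removeNth φ) = i.removeNth (Fin.tail φ) := by
        ext j; simp [Fin.removeNth, Fin.tail]
      rw [e1, e2]
    have h4 : (Fin.removeNth 0 φ) = Fin.tail φ := by
      ext j; simp [Fin.removeNth, Fin.tail]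
    have h5 : ∑ i : Fin (m + 1 + 1), (-1 : ℝ) ^ (i : ℕ) * (φ i ξ * wd (m + 1) (i.removeNth φ) A v)
      = φ 0 ξ * wd (m + 1) (Fin.tail φ) A v
        - ∑ i : Fin (m + 1), (-1 : ℝ) ^ (i : ℕ) * Fin.tail φ i ξ *
        wd1 (φ 0) (wd m (i.removeNth (Fin.tail φ)) A) v := by
      rw [Fin.sum_univ_succ, h4, sub_eq_add_neg, ← Finset.sum_neg_distrib]
      congr 1
      · simp
      · refine Finset.sum_congr rfl fun i _ => ?_
        rw [h3, Fin.val_succ, pow_succ, Fin.tail]; ring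
    rw [h5, sub_eq_iff_eq_add.1 h2, pow_succ _ (m + 1), wd_succ φ]
    have h6 : ∀ p q r s : ℝ, p - (r * s + q) = p - q + r * -1 * s := fun p q r s => by ring
    exact h6 _ _ _ _

end Alg
end

section
open AlternatingMap

section PermSum
variable {V : Type*}

/-- Build a permutation of `Fin (N+1)` from the image of `0` and a permutation of the rest. -/
def mkPerm {N : ℕ} (q : Fin (N + 1) × Equiv.Perm (Fin N)) : Equiv.Perm (Fin (N + 1)) :=
  q.1.cycleRange.symm * Equiv.Perm.decomposeFin.symm (0, q.2)

theorem mkPerm_zero {N : ℕ} (q : Fin (N + 1) × Equiv.Perm (Fin N)) : mkPerm q 0 = q.1 := by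
  simp [mkPerm]

theorem mkPerm_succ {N : ℕ} (q : Fin (N + 1) × Equiv.Perm (Fin N)) (j : Fin N) :
    mkPerm q j.succ = q.1.succAbove (q.2 j) := by
  simp [mkPerm]

theorem mkPerm_bij {N : ℕ} : Function.Bijective (mkPerm (N := N)) := by
  rw [Fintype.bijective_iff_injective_and_card]
  constructor
  · rintro ⟨i, s⟩ ⟨j, t⟩ h
    have h0 : i = j := by
      have := congrArg (fun e => e 0) h
      simpa [mkPerm_zero] using this
    subst h0
    have : s = t := by
      ext x
      have := congrArg (fun e => e x.succ) h
      simp only [mkPerm_succ] at this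
      rw [Fin.succAbove_right_injective this]
    rw [this]
  · simp [Fintype.card_perm, Nat.factorial_succ]

theorem sign_mkPerm {N : ℕ} (q : Fin (N + 1) × Equiv.Perm (Fin N)) :
    (((Equiv.Perm.sign (mkPerm q) : ℤ)) : ℝ) = (-1) ^ (q.1 : ℕ) * ((Equiv.Perm.sign q.2 : ℤ) : ℝ) := by
  rw [mkPerm, Equiv.Perm.sign_mul, Equiv.Perm.sign_symm, Fin.sign_cycleRange,
    Equiv.Perm.decomposeFin.symm_sign]
  simp

theorem perm_sum {N : ℕ} (F : (Fin (N + 1) → V) → ℝ) (v : Fin (N + 1) → V) :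
    ∑ σ : Equiv.Perm (Fin (N + 1)), ((Equiv.Perm.sign σ : ℤ) : ℝ) * F (fun j => v (σ j))
      = ∑ i : Fin (N + 1), (-1 : ℝ) ^ (i : ℕ) * ∑ τ : Equiv.Perm (Fin N),
          ((Equiv.Perm.sign τ : ℤ) : ℝ) * F (Fin.cons (v i) (fun j => i.removeNth v (τ j))) := by
  rw [← (Equiv.ofBijective _ (mkPerm_bij (N := N))).sum_comp, Fintype.sum_prod_type]
  refine Finset.sum_congr rfl fun i _ => ?_
  rw [Finset.mul_sum]
  refine Finset.sum_congr rfl fun τ _ => ?_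
  rw [Equiv.ofBijective_apply, sign_mkPerm, mul_assoc]
  congr 3
  ext j
  refine Fin.cases ?_ (fun j => ?_) j
  · rw [mkPerm_zero]; rfl
  · rw [mkPerm_succ]; rfl

theorem perm_sum_cast {N N' : ℕ} (h : N = N') (F : (Fin N' → V) → ℝ) (v : Fin N' → V) :
    ∑ σ : Equiv.Perm (Fin N'), ((Equiv.Perm.sign σ : ℤ) : ℝ) * F (fun j => v (σ j))
      = ∑ σ : Equiv.Perm (Fin N), ((Equiv.Perm.sign σ : ℤ) : ℝ) *
          F (fun j => v (Fin.cast h (σ (Fin.cast h.symm j)))) := by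
  subst h; rfl

variable [AddCommGroup V] [Module ℝ V]

/-- The un-normalised alternation sum. -/
def altS {l : ℕ} (m : ℕ) (φ : Fin m → V →ₗ[ℝ] ℝ) (A : V [⋀^Fin l]→ₗ[ℝ] ℝ)
    (v : Fin (m + l) → V) : ℝ :=
  ∑ σ : Equiv.Perm (Fin (m + l)), ((Equiv.Perm.sign σ : ℤ) : ℝ) *
    ((∏ i : Fin m, φ i (v (σ (Fin.castAdd l i)))) * A (fun j : Fin l => v (σ (Fin.natAdd m j))))

theorem altS_eq {l : ℕ} (m : ℕ) (φ : Fin m → V →ₗ[ℝ] ℝ) (A : V [⋀^Fin l]→ₗ[ℝ] ℝ)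
    (v : Fin (m + l) → V) :
    altS m φ A v = l.factorial * wd m φ A (fun j => v (Fin.cast (by omega) j)) := by
  induction m with
  | zero =>
    have key := perm_sum_cast (show l = 0 + l by omega)
      (fun w : Fin (0 + l) → V => A (fun j => w (Fin.natAdd 0 j))) v
    simp only [altS, Finset.univ_eq_empty, Finset.prod_empty, one_mul]
    rw [key, wd_zero]
    have : ∀ σ : Equiv.Perm (Fin l), ((Equiv.Perm.sign σ : ℤ) : ℝ) *
        A (fun j => v (Fin.cast (by omega) (σ (Fin.cast (by omega) (Fin.natAdd 0 j)))))
        = A (fun j => v (Fin.cast (by omega) j)) := by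
      intro σ
      have h1 := A.map_perm (fun j => v (Fin.cast (by omega) j)) σ
      have h2 : (fun j => v (Fin.cast (by omega) (σ (Fin.cast (by omega) (Fin.natAdd 0 j)))))
        = (fun j => v (Fin.cast (by omega : l = 0 + l) j)) ∘ σ := by
        ext j
        simp only [Function.comp]
        congr 3
        ext; simp
      rw [h2, h1]
      rcases Int.units_eq_one_or (Equiv.Perm.sign σ) with h | h <;> simp [h]
    simp only [this]
    simp [Fintype.card_perm]
  | succ m ih =>
    have key := perm_sum_cast (show m + l + 1 = m + 1 + l by omega)
      (fun w : Fin (m + 1 + l) → V => (∏ i : Fin (m + 1), φ i (w (Fin.castAdd l i))) *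
        A (fun j => w (Fin.natAdd (m + 1) j))) v
    have key2 := perm_sum
      (fun w : Fin (m + l + 1) → V => (∏ i : Fin (m + 1), φ i (w (Fin.cast (by omega)
        (Fin.castAdd l i)))) *
        A (fun j => w (Fin.cast (by omega) (Fin.natAdd (m + 1) j))))
        (fun j => v (Fin.cast (by omega) j))
    rw [altS, key]
    refine key2.trans ?_
    rw [wd_succ]
    have h3 := wd1_cast (show m + l = l + m by omega) (φ 0)
      ((wd m (Fin.tail φ) A).domDomCongr (finCongr (show l + m = m + l by omega)))
      (wd m (Fin.tail φ) A) (fun w => rfl) (fun j => v (Fin.cast (by omega) j))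
    refine Eq.trans ?_ (congrArg (fun t => (l.factorial : ℝ) * t) h3)
    rw [wd1_apply, Finset.mul_sum]
    refine Finset.sum_congr rfl fun i _ => ?_
    have ih' := ih (Fin.tail φ) (i.removeNth fun j => v (Fin.cast (by omega) j))
    rw [mul_left_comm (l.factorial : ℝ)]
    congr 1
    rw [mul_left_comm]
    refine Eq.trans ?_ (congrArg (fun t => φ 0 (v (Fin.cast (by omega) i)) * t) ih')
    rw [altS, Finset.mul_sum]
    refine Finset.sum_congr rfl fun τ _ => ?_
    rw [mul_left_comm (φ 0 _)]
    congr 1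
    rw [Fin.prod_univ_succ, ← mul_assoc]
    congr 1
    congr 2
    ext j
    have : Fin.cast (by omega : m + 1 + l = m + l + 1) (Fin.natAdd (m + 1) j)
      = (Fin.natAdd m j).succ := by ext; simp; omega
    rw [this, Fin.cons_succ]

theorem det_sum {l : ℕ} (m : ℕ) (φ : Fin m → V →ₗ[ℝ] ℝ) (A : V [⋀^Fin l]→ₗ[ℝ] ℝ)
    (v : Fin (m + l) → V) :
    ∑ σ : Equiv.Perm (Fin (m + l)),
      ((Equiv.Perm.sign σ : ℤ) : ℝ) *
        Matrix.det (Matrix.of fun (i j : Fin m) => φ i (v (σ (Fin.castAdd l j)))) *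
        A (fun j : Fin l => v (σ (Fin.natAdd m j))) = m.factorial * altS m φ A v := by
  simp only [Matrix.det_apply', Finset.mul_sum, Finset.sum_mul]
  rw [Finset.sum_comm]
  have : ∀ π : Equiv.Perm (Fin m), ∑ σ : Equiv.Perm (Fin (m + l)),
      ((Equiv.Perm.sign σ : ℤ) : ℝ) * (((Equiv.Perm.sign π : ℤ) : ℝ) *
        ∏ i, (Matrix.of fun (i j : Fin m) => φ i (v (σ (Fin.castAdd l j)))) (π i) i) *
        A (fun j : Fin l => v (σ (Fin.natAdd m j))) = altS m φ A v := by
    intro π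
    let P : Equiv.Perm (Fin (m + l)) := finSumFinEquiv.permCongr (Equiv.Perm.sumCongr π 1)
    have hs : Equiv.Perm.sign P = Equiv.Perm.sign π := by
      simp [P, Equiv.Perm.sign_permCongr, Equiv.Perm.sign_sumCongr]
    have h1 : ∀ i, P (Fin.castAdd l i) = Fin.castAdd l (π i) := by
      intro i; simp [P, Equiv.permCongr_apply]
    have h2 : ∀ i, P (Fin.natAdd m i) = Fin.natAdd m i := by
      intro i; simp [P, Equiv.permCongr_apply]
    rw [altS, ← Equiv.sum_comp (Equiv.mulRight P)]
    refine Finset.sum_congr rfl fun σ _ => ?_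
    simp only [Equiv.coe_mulRight, Equiv.Perm.sign_mul, hs, Equiv.Perm.mul_apply, h2, h1,
      Matrix.of_apply]
    rw [Equiv.prod_comp π (fun i => φ i (v (σ (Fin.castAdd l i))))]
    rcases Int.units_eq_one_or (Equiv.Perm.sign π) with h | h <;> simp [h, mul_assoc]
  rw [Finset.sum_congr rfl fun π _ => this π]
  simp [Fintype.card_perm]
end PermSum

/-- The covector `dx^α`. -/
def dxl {n k : ℕ} (α : Fin n) : Mfd n k →ₗ[ℝ] ℝ :=
  LinearMap.proj (Fin.castAdd k α) ∘ₗ LinearMap.fst ℝ _ _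

theorem wedge_eq {n k l m : ℕ} (α : Fin m → Fin n) (a : Form n k l) (x : Mfd n k)
    (A : Mfd n k [⋀^Fin l]→ₗ[ℝ] ℝ) (hA : ∀ v, a x v = A v) (v : Fin (m + l) → Mfd n k) :
    wedgeDxR l m α a x v
      = wd m (fun i => dxl (α i)) A (fun j => v (Fin.cast (by omega) j)) := by
  have h := det_sum m (fun i => dxl (k := k) (α i)) A v
  rw [altS_eq] at h
  simp only [wedgeDxR, hA]
  refine (congrArg _ h).trans ?_
  have h1 : (m.factorial : ℝ) ≠ 0 := by positivity
  have h2 : (l.factorial : ℝ) ≠ 0 := by positivity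
  push_cast
  field_simp

end

section
open AlternatingMap

theorem tauMon_eq {n m : ℕ} (α : Fin m → Fin n) :
    tauMon α = ExteriorAlgebra.ιMulti ℝ m (fun i => (Pi.single (α i) (1 : ℝ) : Fin n → ℝ)) := rfl

theorem tauMon_mul {n m : ℕ} (γ : Fin m → Fin n) (α : Fin n) :
    tauMon γ * ExteriorAlgebra.ι ℝ (Pi.single α (1 : ℝ)) = tauMon (Fin.snoc γ α : Fin (m + 1) → Fin n) := by
  rw [tauMon, tauMon, List.ofFn_succ', List.concat_eq_append, List.prod_append]
  simp

theorem tauMon_mul_zero {n m : ℕ} (γ : Fin m → Fin n) (α : Fin n) (h : α ∈ Set.range γ) :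
    tauMon γ * ExteriorAlgebra.ι ℝ (Pi.single α (1 : ℝ)) = 0 := by
  obtain ⟨i, rfl⟩ := h
  rw [tauMon_mul, tauMon_eq]
  refine AlternatingMap.map_eq_zero_of_eq _ _ (i := i.castSucc) (j := Fin.last m) ?_ ?_
  · simp
  · exact (Fin.castSucc_lt_last i).ne

theorem tauMon_remove {n m : ℕ} (β : Fin (m + 1) → Fin n) (i : Fin (m + 1)) :
    tauMon β = ((-1 : ℝ) ^ (m + (i : ℕ))) •
      (tauMon (i.removeNth β) * ExteriorAlgebra.ι ℝ (Pi.single (β i) (1 : ℝ))) := by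
  set e : Fin n → (Fin n → ℝ) := fun j => Pi.single j (1 : ℝ) with he
  have h1 := (ExteriorAlgebra.ιMulti ℝ (M := Fin n → ℝ) (m + 1)).map_insertNth i (e (β i))
    (fun j => e (i.removeNth β j))
  have h2 := (ExteriorAlgebra.ιMulti ℝ (M := Fin n → ℝ) (m + 1)).neg_one_pow_smul_map_insertNth
    (Fin.last m) (e (β i)) (fun j => e (i.removeNth β j))
  have e1 : (i.insertNth (e (β i)) (fun j => e (i.removeNth β j)) : Fin (m + 1) → Fin n → ℝ)
      = fun j => e (β j) := by
    ext1 j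
    refine Fin.succAboveCases i ?_ (fun j => ?_) j <;> simp [Fin.removeNth]
  have e2 : ((Fin.last m).insertNth (e (β i)) (fun j => e (i.removeNth β j)) :
      Fin (m + 1) → Fin n → ℝ)
      = fun j => e ((Fin.snoc (i.removeNth β) (β i) : Fin (m + 1) → Fin n) j) := by
    ext1 j
    rw [Fin.insertNth_last']
    refine Fin.lastCases ?_ (fun j => ?_) j <;> simp
  rw [e1, ← h2, e2, smul_smul, ← pow_add] at h1
  rw [tauMon_mul, tauMon_eq, tauMon_eq]
  refine h1.trans ?_
  rw [Fin.val_last, add_comm m (i : ℕ)]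
  rcases Nat.even_or_odd ((i : ℕ) + m) with h | h <;> simp [h.neg_one_pow, he]

theorem IncP.strictMono {d e : ℕ} {μ : Fin d → Fin e} (h : IncP μ) : StrictMono μ :=
  fun a b hab => h a b hab

theorem range_removeNth {n m : ℕ} (β : Fin (m + 1) → Fin n) (i : Fin (m + 1)) :
    insert (β i) (Set.range (i.removeNth β)) = Set.range β := by
  ext t
  simp only [Set.mem_insert_iff, Set.mem_range, Fin.removeNth]
  constructor
  · rintro (h | ⟨j, h⟩)
    · exact ⟨i, h.symm⟩
    · exact ⟨_, h⟩
  · rintro ⟨j, h⟩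
    rcases eq_or_ne j i with rfl | hj
    · exact Or.inl h.symm
    · obtain ⟨j, rfl⟩ := Fin.exists_succAbove_eq hj
      exact Or.inr ⟨j, h⟩

theorem exists_insert {n m : ℕ} (γ : Fin m → Fin n) (hγ : IncP γ) (α : Fin n)
    (h : α ∉ Set.range γ) :
    ∃ β : Fin (m + 1) → Fin n, IncP β ∧ ∃ i, i.removeNth β = γ ∧ β i = α := by
  classical
  let S : Finset (Fin n) := insert α (Finset.univ.image γ)
  have hS : S.card = m + 1 := by
    rw [Finset.card_insert_of_notMem (by simpa using h),
      Finset.card_image_of_injective _ hγ.strictMono.injective]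
    simp
  let β := S.orderEmbOfFin hS
  have hr : Set.range β = insert α (Set.range γ) := by
    rw [Finset.range_orderEmbOfFin]; simp [S]
  have hm : StrictMono β := β.strictMono
  obtain ⟨i, hi⟩ : α ∈ Set.range β := by rw [hr]; exact Set.mem_insert _ _
  refine ⟨β, fun a b hab => hm hab, i, ?_, hi⟩
  have hm' : StrictMono (i.removeNth (β : Fin (m + 1) → Fin n)) :=
    hm.comp (Fin.strictMono_succAbove i)
  rw [← hm'.range_inj hγ.strictMono]
  have h1 := range_removeNth (β : Fin (m + 1) → Fin n) i
  rw [hr, hi] at h1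
  have h2 : α ∉ Set.range (i.removeNth (β : Fin (m + 1) → Fin n)) := by
    rintro ⟨j, hj⟩
    rw [← hi] at hj
    exact Fin.succAbove_ne i j (hm.injective hj)
  have := congrArg (fun s => s \ {α}) h1
  simpa [Set.insert_sdiff_of_mem, Set.sdiff_singleton_eq_self h2, Set.sdiff_singleton_eq_self h]
    using this

theorem comb {n m : ℕ} (ξ : Fin n → ℝ) (c : (Fin m → Fin n) → ℝ) :
    ∑ β : {β : Fin (m + 1) → Fin n // IncP β},
      ((-1 : ℝ) ^ (m + 1) * ∑ i : Fin (m + 1), (-1 : ℝ) ^ (i : ℕ) *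
        (ξ (β.1 i) * c (i.removeNth β.1))) • tauMon β.1
    = - ∑ γ : {γ : Fin m → Fin n // IncP γ}, c γ.1 • (tauMon γ.1 *
        ∑ α : Fin n, ξ α • ExteriorAlgebra.ι ℝ (Pi.single α (1 : ℝ))) := by
  simp only [Finset.mul_sum, Finset.sum_smul, Finset.smul_sum]
  rw [← Fintype.sum_prod_type', ← Fintype.sum_prod_type', ← Finset.sum_neg_distrib]
  refine Finset.sum_of_injOn (fun q => (⟨q.2.removeNth q.1.1, fun a b hab =>
      q.1.2 _ _ (Fin.strictMono_succAbove q.2 hab)⟩, q.1.1 q.2)) ?_ ?_ ?_ ?_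
  · rintro ⟨⟨β, hβ⟩, i⟩ - ⟨⟨β', hβ'⟩, i'⟩ - h
    simp only [Prod.mk.injEq] at h
    have h0 := congrArg Subtype.val h.1
    simp only at h0
    have h1 := range_removeNth β i
    rw [h0, h.2, range_removeNth β' i', hβ'.strictMono.range_inj hβ.strictMono] at h1
    subst h1
    have := hβ'.strictMono.injective h.2
    subst this
    rfl
  · intro q _; simp
  · rintro ⟨⟨γ, hγ⟩, α⟩ - h
    have : α ∈ Set.range γ := by
      by_contra hα
      obtain ⟨β, hβ, i, hi, hi'⟩ := exists_insert γ hγ α hα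
      refine h ⟨(⟨β, hβ⟩, i), by simp, ?_⟩
      simp [hi, hi']
    simp [tauMon_mul_zero γ α this]
  · rintro ⟨⟨β, hβ⟩, i⟩ -
    simp only
    rw [tauMon_remove β i, smul_smul, mul_smul_comm, smul_smul, ← neg_smul]
    congr 1
    have : (-1 : ℝ) ^ (m + 1) * (-1) ^ (i : ℕ) * (-1) ^ (m + (i : ℕ)) = -1 := by
      rw [← pow_add, ← pow_add]
      exact Odd.neg_one_pow ⟨m + i, by ring⟩
    linear_combination (ξ (β i) * c (i.removeNth β)) * this

end

section
open AlternatingMap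

section An
variable {n k l : ℕ}

/-- The derivative of a form, as a linear map to alternating maps. -/
def derB (b : Mfd n k → AlternatingMap ℝ (Mfd n k) ℝ (Fin l))
    (hb : ∀ v, ContDiff ℝ (⊤ : ℕ∞) (fun x => b x v)) (x : Mfd n k) :
    Mfd n k →ₗ[ℝ] Mfd n k [⋀^Fin l]→ₗ[ℝ] ℝ where
  toFun u :=
    { toFun := fun w => fderiv ℝ (fun y => b y w) x u
      map_update_add' := by
        intro _ w i p q
        have hd : ∀ v, DifferentiableAt ℝ (fun y => b y v) x :=
          fun v => ((hb v).differentiable (by simp)).differentiableAt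
        simp only [AlternatingMap.map_update_add]
        rw [fderiv_fun_add (hd _) (hd _)]
        rfl
      map_update_smul' := by
        intro _ w i c p
        have hd : ∀ v, DifferentiableAt ℝ (fun y => b y v) x :=
          fun v => ((hb v).differentiable (by simp)).differentiableAt
        simp only [AlternatingMap.map_update_smul]
        rw [fderiv_fun_const_smul (hd _)]
        rfl
      map_eq_zero_of_eq' := by
        intro w i j h hij
        have : (fun y => b y w) = fun _ => 0 := by
          ext y; exact (b y).map_eq_zero_of_eq w h hij
        simp [this] }
  map_add' u u' := by ext w; simp
  map_smul' c u := by ext w; simp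

theorem derB_apply (b : Mfd n k → AlternatingMap ℝ (Mfd n k) ℝ (Fin l))
    (hb : ∀ v, ContDiff ℝ (⊤ : ℕ∞) (fun x => b x v)) (x u : Mfd n k) (w : Fin l → Mfd n k) :
    derB b hb x u w = fderiv ℝ (fun y => b y w) x u := rfl

theorem neg_one_zsmul (i : ℕ) (r : ℝ) : ((-1 : ℤ) ^ i) • r = (-1 : ℝ) ^ i * r := by
  rcases Nat.even_or_odd i with h | h <;> simp [h.neg_one_pow]

theorem extD_eq (b : Mfd n k → AlternatingMap ℝ (Mfd n k) ℝ (Fin l))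
    (hb : ∀ v, ContDiff ℝ (⊤ : ℕ∞) (fun x => b x v)) (x : Mfd n k) (v : Fin (l + 1) → Mfd n k) :
    extD (fun y w => b y w) x v = alternatizeUncurryFin (derB b hb x) v := by
  rw [alternatizeUncurryFin_apply, extD]
  refine Finset.sum_congr rfl fun i _ => ?_
  rw [neg_one_zsmul, derB_apply]

theorem fderiv_wedge {m : ℕ} (β : Fin m → Fin n)
    (b : Mfd n k → AlternatingMap ℝ (Mfd n k) ℝ (Fin l))
    (hb : ∀ v, ContDiff ℝ (⊤ : ℕ∞) (fun x => b x v)) (x u : Mfd n k)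
    (w : Fin (m + l) → Mfd n k) :
    fderiv ℝ (fun y => wedgeDxR l m β (fun y w => b y w) y w) x u
      = wd m (fun i => dxl (β i)) (derB b hb x u) (fun j => w (Fin.cast (by omega) j)) := by
  rw [← wedge_eq β (fun _ w => derB b hb x u w) x _ (fun _ => rfl)]
  have hd : ∀ v, DifferentiableAt ℝ (fun y => b y v) x :=
    fun v => ((hb v).differentiable (by simp)).differentiableAt
  simp only [wedgeDxR]
  rw [fderiv_const_mul (by fun_prop), fderiv_fun_sum (by fun_prop)]
  simp only [_root_.smul_apply, _root_.sum_apply, smul_eq_mul]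
  congr 1
  refine Finset.sum_congr rfl fun σ _ => ?_
  rw [fderiv_const_mul (hd _)]
  rfl

theorem cast_alt {N N' : ℕ} (h : N = N') (B : Mfd n k →ₗ[ℝ] Mfd n k [⋀^Fin N']→ₗ[ℝ] ℝ)
    (v : Fin (N + 1) → Mfd n k) :
    ∑ i : Fin (N + 1), (-1 : ℝ) ^ (i : ℕ) *
      B (v i) (fun j => i.removeNth v (Fin.cast h.symm j))
      = alternatizeUncurryFin B (fun j => v (Fin.cast (by rw [h]) j)) := by
  subst h
  rw [alternatizeUncurryFin_apply]
  refine Finset.sum_congr rfl fun i _ => ?_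
  rw [neg_one_zsmul]
  rfl

theorem extD_wedge {m : ℕ} (β : Fin m → Fin n)
    (b : Mfd n k → AlternatingMap ℝ (Mfd n k) ℝ (Fin l))
    (hb : ∀ v, ContDiff ℝ (⊤ : ℕ∞) (fun x => b x v)) (x : Mfd n k)
    (v : Fin (m + l + 1) → Mfd n k) :
    extD (wedgeDxR l m β (fun y w => b y w)) x v
      = (-1) ^ m * wd m (fun i => dxl (β i)) (alternatizeUncurryFin (derB b hb x))
          (fun j => v (Fin.cast (by omega) j)) := by
  have h := cast_alt (show m + l = l + m by omega) (wd m (fun i => dxl (β i)) ∘ₗ derB b hb x) v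
  rw [alt_wd] at h
  rw [extD]
  refine Eq.trans (Finset.sum_congr rfl fun i _ => ?_) h
  rw [fderiv_wedge β b hb]
  rfl

theorem cons_cast {V : Type*} {N N' : ℕ} (h : N = N') (ξ : V) (v : Fin N' → V) :
    (fun j : Fin (N' + 1) => (Fin.cons ξ (fun i : Fin N => v (Fin.cast h i)) : Fin (N + 1) → V)
      (Fin.cast (by rw [h]) j)) = Fin.cons ξ v := by
  subst h; rfl

theorem iota_formula {m : ℕ} (β : Fin (m + 1) → Fin n)
    (b : Mfd n k → AlternatingMap ℝ (Mfd n k) ℝ (Fin l))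
    (hb : ∀ v, ContDiff ℝ (⊤ : ℕ∞) (fun x => b x v)) (Xia : Mfd n k → Mfd n k) (x : Mfd n k)
    (v : Fin (l + m + 1) → Mfd n k)
    (hc : m + 1 + l = l + m + 1) (hc' : m + (l + 1) = l + m + 1) :
    iota Xia (extD (wedgeDxR l (m + 1) β (fun y w => b y w))) x
        (fun j => v (Fin.cast hc j))
      = (-1) ^ (m + 1) * (∑ i : Fin (m + 1), (-1 : ℝ) ^ (i : ℕ) *
          ((Xia x).1 (Fin.castAdd k (β i)) *
            wedgeDxR (l + 1) m (i.removeNth β) (extD (fun y w => b y w)) x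
              (fun j => v (Fin.cast hc' j))))
        + wedgeDxR l (m + 1) β (fun y w => extD (fun y' w' => b y' w') y (Fin.cons (Xia y) w)) x
            (fun j => v (Fin.cast hc j)) := by
  rw [iota, extD_wedge β b hb,
    wedge_eq β _ x ((alternatizeUncurryFin (derB b hb x)).curryLeft (Xia x))
      (fun w => by rw [extD_eq b hb]; rfl)]
  have h1 : ∀ i : Fin (m + 1), wedgeDxR (l + 1) m (i.removeNth β) (extD (fun y w => b y w)) x
      (fun j => v (Fin.cast hc' j)) = _ :=
    fun i => wedge_eq (i.removeNth β) _ x (alternatizeUncurryFin (derB b hb x))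
      (fun w => extD_eq b hb x w) _
  simp only [h1]
  have h2 := wd_cons m (fun i => dxl (k := k) (β i)) (alternatizeUncurryFin (derB b hb x)) (Xia x)
    (fun j => v (Fin.cast (by omega) j))
  have h3 := cons_cast (show m + 1 + l = l + 1 + m by omega) (Xia x)
    (fun j => v (Fin.cast (by omega) j))
  rw [← h3] at h2
  refine (congrArg (fun t => (-1 : ℝ) ^ (m + 1) * t) h2).trans ?_
  rw [mul_add, ← mul_assoc, ← pow_add, Even.neg_one_pow ⟨m + 1, rfl⟩, one_mul]
  rfl

end An
end

/-- (Proposition 2b.) Here the dimension of `X` is `n = lb + mmb + 2`, with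
`a ∈ 𝔓^{n-1}M` and `b ∈ 𝔓^{p-1}M`, where `p - 1 = lb` and `n - p = mmb + 1`
(so `1 ≤ p < n`). Then `{a, ˢb}_s = −ˢ(db)·Ξ(a)(τ) + ˢ{a,b}` where `{a,b} = Ξ(a)⌟db`
is the external 𝔭-bracket; consequently, if `dx^α(Ξ(a)) = 0` for all `α`, the internal
𝔭-bracket `{a,b}` exists and coincides with the external one. -/
theorem sbracket_top_with_low_degree
    (lb mmb k : ℕ)
    (a : Form (lb + mmb + 2) k (lb + mmb + 1))
    (ha : SmoothF a)
    (Xia : Mfd (lb + mmb + 2) k → Mfd (lb + mmb + 2) k)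
    (hXia : ∀ (x : Mfd (lb + mmb + 2) k) (v : Fin (lb + mmb + 2) → Mfd (lb + mmb + 2) k),
      extD a x v = - iota Xia (Omega (lb + mmb + 2) k) x v)
    (b : Mfd (lb + mmb + 2) k → AlternatingMap ℝ (Mfd (lb + mmb + 2) k) ℝ (Fin lb))
    (hb : ∀ v, ContDiff ℝ (⊤ : ℕ∞) (fun x => b x v))
    (XiB : (Fin (mmb + 1) → Fin (lb + mmb + 2)) →
      Mfd (lb + mmb + 2) k → Mfd (lb + mmb + 2) k)
    (hXiB : ∀ β : Fin (mmb + 1) → Fin (lb + mmb + 2), IncP β →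
      ∀ (x : Mfd (lb + mmb + 2) k) (v : Fin (lb + mmb + 2) → Mfd (lb + mmb + 2) k),
        extD (wedgeDxR lb (mmb + 1) β (fun y w => b y w)) x
            (fun j => v (Fin.cast (by omega) j))
          = - iota (XiB β) (Omega (lb + mmb + 2) k) x v) :
    -- `{a, ˢb}_s = −ˢ(db)·Ξ(a)(τ) + ˢ{a,b}`:
    (∀ (x : Mfd (lb + mmb + 2) k) (v : Fin (lb + mmb + 1) → Mfd (lb + mmb + 2) k),
      (∑ β : {β : Fin (mmb + 1) → Fin (lb + mmb + 2) // IncP β},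
          (iota Xia (extD (wedgeDxR lb (mmb + 1) β.1 (fun y w => b y w))) x
              (fun j => v (Fin.cast (by omega) j)))
            • tauMon β.1)
        = - (∑ γ : {γ : Fin mmb → Fin (lb + mmb + 2) // IncP γ},
              (wedgeDxR (lb + 1) mmb γ.1 (extD (fun y w => b y w)) x
                  (fun j => v (Fin.cast (by omega) j)))
                • (tauMon γ.1 * XiTau Xia x))
          + ∑ β : {β : Fin (mmb + 1) → Fin (lb + mmb + 2) // IncP β},
              (wedgeDxR lb (mmb + 1) β.1
                  (fun y w => extD (fun y' w' => b y' w') y (Fin.cons (Xia y) w)) x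
                  (fun j => v (Fin.cast (by omega) j)))
                • tauMon β.1)
    ∧
    -- consequently, if `dx^α(Ξ(a)) = 0` for all `α`, the internal bracket exists and
    -- coincides with the external bracket `Ξ(a) ⌟ db`:
    ((∀ (x : Mfd (lb + mmb + 2) k) (α : Fin (lb + mmb + 2)),
        (Xia x).1 (Fin.castAdd k α) = 0) →
      ∀ (x : Mfd (lb + mmb + 2) k) (v : Fin (lb + mmb + 1) → Mfd (lb + mmb + 2) k),
        (∑ β : {β : Fin (mmb + 1) → Fin (lb + mmb + 2) // IncP β},
            (iota Xia (extD (wedgeDxR lb (mmb + 1) β.1 (fun y w => b y w))) x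
                (fun j => v (Fin.cast (by omega) j)))
              • tauMon β.1)
          = ∑ β : {β : Fin (mmb + 1) → Fin (lb + mmb + 2) // IncP β},
              (wedgeDxR lb (mmb + 1) β.1
                  (fun y w => extD (fun y' w' => b y' w') y (Fin.cons (Xia y) w)) x
                  (fun j => v (Fin.cast (by omega) j)))
                • tauMon β.1) := by
  have main : ∀ (x : Mfd (lb + mmb + 2) k) (v : Fin (lb + mmb + 1) → Mfd (lb + mmb + 2) k),
      (∑ β : {β : Fin (mmb + 1) → Fin (lb + mmb + 2) // IncP β},
          (iota Xia (extD (wedgeDxR lb (mmb + 1) β.1 (fun y w => b y w))) x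
              (fun j => v (Fin.cast (by omega) j)))
            • tauMon β.1)
        = - (∑ γ : {γ : Fin mmb → Fin (lb + mmb + 2) // IncP γ},
              (wedgeDxR (lb + 1) mmb γ.1 (extD (fun y w => b y w)) x
                  (fun j => v (Fin.cast (by omega) j)))
                • (tauMon γ.1 * XiTau Xia x))
          + ∑ β : {β : Fin (mmb + 1) → Fin (lb + mmb + 2) // IncP β},
              (wedgeDxR lb (mmb + 1) β.1
                  (fun y w => extD (fun y' w' => b y' w') y (Fin.cons (Xia y) w)) x
                  (fun j => v (Fin.cast (by omega) j)))
                • tauMon β.1 := by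
    intro x v
    have h1 := comb (fun α => (Xia x).1 (Fin.castAdd k α))
      (fun γ : Fin mmb → Fin (lb + mmb + 2) =>
        wedgeDxR (lb + 1) mmb γ (extD (fun y w => b y w)) x (fun j => v (Fin.cast (by omega) j)))
    simp only [XiTau]
    rw [← h1, ← Finset.sum_add_distrib]
    refine Finset.sum_congr rfl fun β _ => ?_
    rw [iota_formula β.1 b hb Xia x v (by omega) (by omega), add_smul]
  refine ⟨main, fun h0 x v => ?_⟩
  rw [main x v]
  have hX : XiTau Xia x = 0 := by simp [XiTau, h0]
  simp [hX]


end Pataplectic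

end
end

section
/- (Theorem 3) Let H be a smooth Hamiltonian on M and let Γ be the graph over X of a solution x ↦ U(x) = (x,u(x),p(x)) of the Hamilton equations (∂U/∂x^1∧…∧∂U/∂x^n)⌟Ω = (∂U/∂x^1∧…∧∂U/∂x^n)⌟(dH∧ω). Then for every 1 ≤ p ≤ n, every a ∈ 𝔓^{p−1}M and every oriented p-dimensional submanifold with boundary D ⊂ Γ: ∫_D da = ∫_{D_Γ} {Hω, ^s a}_s, where ∫_{D_Γ} {Hω, ^s a}_s := −∫_D Σ_{α1<…<α_{n−p}} ( X_{α1}∧…∧X_{α_{n−p}} ∧ Ξ(dx^{α1}∧…∧dx^{α_{n−p}}∧a) )⌟ d(Hω), X = X_1∧…∧X_n being the tangent n-vector to Γ normalized by dx^α(X_β) = δ^α_β. -/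
open scoped BigOperators
open MeasureTheory

noncomputable section

namespace Pataplectic

variable (n k : ℕ)

variable {n k}

variable (n k)

/-- The wedge product `dx^{α₁} ∧ … ∧ dx^{α_m} ∧ a` of coordinate 1-forms of `X`
with an `l`-form `a` on `M`, via the standard alternation formula. -/
def wedgeDxA {n k : ℕ} (l m : ℕ) (α : Fin m → Fin n)
    (a : Mfd n k → AlternatingMap ℝ (Mfd n k) ℝ (Fin l)) : Form n k (m + l) :=
  fun x v => (((m.factorial * l.factorial : ℕ) : ℝ))⁻¹ *
    ∑ σ : Equiv.Perm (Fin (m + l)),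
      ((Equiv.Perm.sign σ : ℤ) : ℝ) *
        Matrix.det (Matrix.of fun (i j : Fin m) =>
          (v (σ (Fin.castAdd l j))).1 (Fin.castAdd k (α i))) *
        a x (fun j : Fin l => v (σ (Fin.natAdd m j)))

/- Here the dimension of `X` is `n = la + m + 1`, and `a ∈ 𝔓^{p-1}M` with
`p - 1 = la` and `n - p = m` (so `1 ≤ p ≤ n`), and `D ⊆ Γ` is a `p`-dimensional
oriented piece of the graph `Γ`, parametrized over `Δ ⊆ ℝᵖ` through `Γ`'s graph map. -/
variable (la m k : ℕ)

/-- The graph map `U : x ↦ (x, u(x), p(x)) ∈ M`. -/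
def graphMap (u : (Fin (la + m + 1) → ℝ) → (Fin k → ℝ))
    (pm : (Fin (la + m + 1) → ℝ) → Psp (la + m + 1) k)
    (x : Fin (la + m + 1) → ℝ) : Mfd (la + m + 1) k :=
  (Fin.append x (u x), pm x)

/-- The tangent frame `X₁, …, Xₙ` of the graph of `γ`, normalized by
`dx^α(X_β) = δ^α_β`. -/
def frame (γ : (Fin (la + m + 1) → ℝ) → Mfd (la + m + 1) k)
    (x : Fin (la + m + 1) → ℝ) : Fin (la + m + 1) → Mfd (la + m + 1) k :=
  fun α => fderiv ℝ γ x (Pi.single α 1)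

/-- The `(n+2)`-form `dH ∧ ω` on `M`. -/
def dHomega (H : Mfd (la + m + 1) k → ℝ) : Form (la + m + 1) k (la + m + 2) :=
  fun y w => ∑ i : Fin (la + m + 2),
    (-1 : ℝ) ^ (i : ℕ) * fderiv ℝ H y (w i) * vol (la + m + 1) k y (i.removeNth w)

theorem sumAlt_apply {M ι : Type*} [AddCommGroup M] [Module ℝ M] [Fintype ι] {d : ℕ}
    (F : ι → AlternatingMap ℝ M ℝ (Fin d)) (v : Fin d → M) :
    (∑ i, F i) v = ∑ i, F i v := by
  classical
  induction (Finset.univ : Finset ι) using Finset.induction_on with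
  | empty => simp
  | insert i s hi ih => rw [Finset.sum_insert hi, Finset.sum_insert hi, ← ih]; rfl

/-- The derivative of a family of alternating maps, as a linear family. -/
def derivAlt {n k d : ℕ} (a : Mfd n k → AlternatingMap ℝ (Mfd n k) ℝ (Fin d))
    (ha : ∀ v, Differentiable ℝ (fun x => a x v)) (x : Mfd n k) :
    Mfd n k →ₗ[ℝ] AlternatingMap ℝ (Mfd n k) ℝ (Fin d) where
  toFun v :=
    { toFun := fun w => fderiv ℝ (fun y => a y w) x v
      map_update_add' := by
        intro inst w i p q
        have : inst = instDecidableEqFin d := Subsingleton.elim _ _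
        subst this
        have h : (fun y => a y (Function.update w i (p + q)))
            = (fun y => a y (Function.update w i p)) + (fun y => a y (Function.update w i q)) := by
          funext y; simp
        rw [h, fderiv_add (ha _ x) (ha _ x)]; rfl
      map_update_smul' := by
        intro inst w i c p
        have : inst = instDecidableEqFin d := Subsingleton.elim _ _
        subst this
        have h : (fun y => a y (Function.update w i (c • p)))
            = c • (fun y => a y (Function.update w i p)) := by
          funext y; simp
        rw [h, fderiv_const_smul (ha _ x)]; rfl
      map_eq_zero_of_eq' := by
        intro w i j hw hij
        have h : (fun y => a y w) = fun _ => 0 := by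
          funext y; exact (a y).map_eq_zero_of_eq w hw hij
        rw [h]; simp }
  map_add' p q := by ext w; simp
  map_smul' c p := by ext w; simp

/-- The exterior derivative as an alternating map. -/
def extAlt {n k d : ℕ} (a : Mfd n k → AlternatingMap ℝ (Mfd n k) ℝ (Fin d))
    (ha : ∀ v, Differentiable ℝ (fun x => a x v)) (x : Mfd n k) :
    AlternatingMap ℝ (Mfd n k) ℝ (Fin (d + 1)) :=
  AlternatingMap.alternatizeUncurryFin (derivAlt a ha x)

theorem extAlt_apply {n k d : ℕ} (a : Mfd n k → AlternatingMap ℝ (Mfd n k) ℝ (Fin d))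
    (ha : ∀ v, Differentiable ℝ (fun x => a x v)) (x : Mfd n k) (v : Fin (d + 1) → Mfd n k) :
    extD (fun y w => a y w) x v = extAlt a ha x v := by
  simp only [extAlt, AlternatingMap.alternatizeUncurryFin_apply, extD, derivAlt, zsmul_eq_mul]
  refine Finset.sum_congr rfl fun i _ => ?_
  push_cast
  simp

/-- Coordinate minor as an alternating map. -/
def minorAlt {n k d : ℕ} (μ : Fin d → Fin (n + k)) :
    AlternatingMap ℝ (Mfd n k) ℝ (Fin d) :=
  (Matrix.detRowAlternating (R := ℝ) (n := Fin d)).compLinearMap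
    ((LinearMap.funLeft ℝ ℝ μ).comp (LinearMap.fst ℝ (E n k) (Psp n k)))

theorem minorAlt_apply {n k d : ℕ} (μ : Fin d → Fin (n + k)) (v : Fin d → Mfd n k) :
    minorAlt μ v = Matrix.det (Matrix.of fun a b => (v b).1 (μ a)) := by
  rw [← Matrix.det_transpose]
  rfl

/-- `θ` as a family of alternating maps. -/
def thetaAlt (n k : ℕ) (y : Mfd n k) : AlternatingMap ℝ (Mfd n k) ℝ (Fin n) :=
  ∑ μ : Idx n k, y.2 μ • minorAlt μ.1

theorem thetaAlt_apply (n k : ℕ) (y : Mfd n k) (v : Fin n → Mfd n k) :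
    thetaAlt n k y v = theta n k y v := by
  simp only [thetaAlt, theta, pApply, sumAlt_apply, AlternatingMap.smul_apply,
    minorAlt_apply, smul_eq_mul]

theorem thetaAlt_diff (n k : ℕ) (v : Fin n → Mfd n k) :
    Differentiable ℝ (fun x => thetaAlt n k x v) := by
  simp only [thetaAlt, sumAlt_apply, AlternatingMap.smul_apply, smul_eq_mul]
  fun_prop

theorem Omega_eq (n k : ℕ) (y : Mfd n k) (v : Fin (n + 1) → Mfd n k) :
    Omega n k y v = extAlt (thetaAlt n k) (thetaAlt_diff n k) y v := by
  rw [← extAlt_apply, Omega]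
  congr 1
  funext y w
  exact (thetaAlt_apply n k y w).symm

/-- `H ω` as a family of alternating maps. -/
def HvolAlt {n k : ℕ} (H : Mfd n k → ℝ) (y : Mfd n k) : AlternatingMap ℝ (Mfd n k) ℝ (Fin n) :=
  H y • minorAlt (Fin.castAdd k)

theorem HvolAlt_apply {n k : ℕ} (H : Mfd n k → ℝ) (y : Mfd n k) (v : Fin n → Mfd n k) :
    HvolAlt H y v = H y * vol n k y v := by
  simp only [HvolAlt, AlternatingMap.smul_apply, minorAlt_apply, smul_eq_mul, vol]

theorem HvolAlt_diff {n k : ℕ} (H : Mfd n k → ℝ) (hH : Differentiable ℝ H)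
    (v : Fin n → Mfd n k) : Differentiable ℝ (fun x => HvolAlt H x v) := by
  simp only [HvolAlt, AlternatingMap.smul_apply, smul_eq_mul]
  fun_prop

theorem extD_Hvol_eq {n k : ℕ} (H : Mfd n k → ℝ) (hH : Differentiable ℝ H)
    (y : Mfd n k) (v : Fin (n + 1) → Mfd n k) :
    extD (fun y w => H y * vol n k y w) y v = extAlt (HvolAlt H) (HvolAlt_diff H hH) y v := by
  rw [← extAlt_apply]
  congr 1
  funext y w
  exact (HvolAlt_apply H y w).symm

theorem dHomega_eq (la m k : ℕ) (H : Mfd (la + m + 1) k → ℝ) (hH : Differentiable ℝ H)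
    (y : Mfd (la + m + 1) k) (v : Fin (la + m + 2) → Mfd (la + m + 1) k) :
    dHomega la m k H y v = extAlt (HvolAlt H) (HvolAlt_diff H hH) y v := by
  rw [← extD_Hvol_eq H hH, dHomega, extD]
  refine Finset.sum_congr rfl fun i _ => ?_
  have : (fun y => H y * vol (la + m + 1) k y (i.removeNth v))
    = fun y => H y * vol (la + m + 1) k 0 (i.removeNth v) := rfl
  rw [this, fderiv_mul_const (hH y)]
  simp only [_root_.smul_apply, smul_eq_mul, vol]
  ring

/-- Agreement on `(X₁,…,Xₙ,V)` spreads to `(V, X_{f 1},…,X_{f n})`. -/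
theorem agree_cons {M : Type*} [AddCommGroup M] [Module ℝ M] {n : ℕ}
    (F G : AlternatingMap ℝ M ℝ (Fin (n + 1))) (X : Fin n → M)
    (h : ∀ V, F (Fin.snoc X V) = G (Fin.snoc X V)) (V : M) (f : Fin n → Fin n) :
    F (Fin.cons V (X ∘ f)) = G (Fin.cons V (X ∘ f)) := by
  by_cases hf : Function.Injective f
  · have hb : Function.Bijective f := Finite.injective_iff_bijective.mp hf
    have hf' : (Fin.snoc (X ∘ f) V : Fin (n + 1) → M)
        = (Fin.snoc X V : Fin (n + 1) → M) ∘
          (finSumFinEquiv.permCongr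
            (Equiv.Perm.sumCongr (Equiv.ofBijective f hb) (Equiv.refl (Fin 1)))) := by
      funext i
      refine Fin.lastCases ?_ (fun i => ?_) i
      · have : Fin.last n = Fin.natAdd n (0 : Fin 1) := by ext; simp
        simp only [Fin.snoc_last, Function.comp_apply, Equiv.permCongr_apply]
        rw [this, finSumFinEquiv_symm_apply_natAdd]
        simp only [Equiv.Perm.sumCongr_apply, Sum.map_inr, Equiv.refl_apply,
          finSumFinEquiv_apply_right]
        rw [← this, Fin.snoc_last]
      · simp only [Fin.snoc_castSucc, Function.comp_apply, Equiv.permCongr_apply]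
        rw [show i.castSucc = Fin.castAdd 1 i from rfl, finSumFinEquiv_symm_apply_castAdd]
        simp only [Equiv.Perm.sumCongr_apply, Sum.map_inl, Equiv.ofBijective_apply,
          finSumFinEquiv_apply_left]
        rw [show Fin.castAdd 1 (f i) = (f i).castSucc from rfl, Fin.snoc_castSucc]
    have h2 : (Fin.cons V (X ∘ f) : Fin (n + 1) → M)
        = (Fin.snoc (X ∘ f) V : Fin (n + 1) → M) ∘ (finRotate (n + 1)).symm := by
      rw [Fin.snoc_eq_cons_rotate]
      funext i; simp
    rw [h2, AlternatingMap.map_perm, AlternatingMap.map_perm, hf', AlternatingMap.map_perm,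
      AlternatingMap.map_perm, h]
  · have : ¬ Function.Injective (Fin.cons V (X ∘ f) : Fin (n + 1) → M) := by
      intro hi
      apply hf
      intro i j hij
      have := @hi i.succ j.succ (by simp [hij])
      exact Fin.succ_injective _ this
    rw [F.map_eq_zero_of_not_injective _ this, G.map_eq_zero_of_not_injective _ this]

theorem wedge_zero {n k : ℕ} (l m : ℕ) (α : Fin m → Fin n)
    (a : Mfd n k → AlternatingMap ℝ (Mfd n k) ℝ (Fin l)) (y : Mfd n k)
    (v : Fin (m + l) → Mfd n k) (i₀ : Fin m)
    (h : ∀ j, (v j).1 (Fin.castAdd k (α i₀)) = 0) : wedgeDxA l m α a y v = 0 := by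
  unfold wedgeDxA
  rw [Finset.sum_eq_zero, mul_zero]
  intro σ _
  rw [Matrix.det_eq_zero_of_row_eq_zero i₀ (fun j => by simp [h])]
  ring

theorem wedge_append {n k : ℕ} (l m : ℕ) (α : Fin m → Fin n)
    (a : Mfd n k → AlternatingMap ℝ (Mfd n k) ℝ (Fin l)) (y : Mfd n k)
    (A : Fin m → Mfd n k) (w : Fin l → Mfd n k)
    (hA : ∀ i j, (A j).1 (Fin.castAdd k (α i)) = if i = j then 1 else 0)
    (hw : ∀ i j, (w j).1 (Fin.castAdd k (α i)) = 0) :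
    wedgeDxA l m α a y (Fin.append A w) = a y w := by
  classical
  set T : Equiv.Perm (Fin m ⊕ Fin l) → ℝ := fun τ =>
    ((Equiv.Perm.sign τ : ℤ) : ℝ) *
        Matrix.det (Matrix.of fun (i j : Fin m) =>
          (Sum.elim A w (τ (Sum.inl j))).1 (Fin.castAdd k (α i))) *
        a y (fun j : Fin l => Sum.elim A w (τ (Sum.inr j))) with hT
  have happ : ∀ s, Fin.append A w (finSumFinEquiv s) = Sum.elim A w s := by
    rintro (s | s) <;> simp
  have h1 : wedgeDxA l m α a y (Fin.append A w)
      = (((m.factorial * l.factorial : ℕ) : ℝ))⁻¹ * ∑ τ, T τ := by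
    unfold wedgeDxA
    congr 1
    symm
    refine Fintype.sum_equiv (finSumFinEquiv.permCongr) _ _ fun τ => ?_
    simp only [hT, Equiv.Perm.sign_permCongr, Equiv.permCongr_apply,
      finSumFinEquiv_symm_apply_castAdd, finSumFinEquiv_symm_apply_natAdd, happ]
  have h2 : ∑ p : Equiv.Perm (Fin m) × Equiv.Perm (Fin l), T (p.1.sumCongr p.2) = ∑ τ, T τ := by
    refine Fintype.sum_of_injective (fun p : Equiv.Perm (Fin m) × Equiv.Perm (Fin l) =>
      (p.1.sumCongr p.2 : Equiv.Perm (Fin m ⊕ Fin l))) ?_ _ _ ?_ (fun _ => rfl)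
    · exact Equiv.Perm.sumCongrHom_injective
    · intro τ hτ
      have h3 : ¬ Set.MapsTo τ (Set.range Sum.inl) (Set.range Sum.inl) := by
        intro hm
        obtain ⟨p, hp⟩ := Equiv.Perm.mem_sumCongrHom_range_of_perm_mapsTo_inl hm
        exact hτ ⟨p, hp⟩
      obtain ⟨j, b, hj⟩ : ∃ j b, τ (Sum.inl j) = Sum.inr b := by
        by_contra hcon
        apply h3
        rintro _ ⟨j, rfl⟩
        rcases hx : τ (Sum.inl j) with c | c
        · exact ⟨c, rfl⟩
        · exact absurd ⟨j, c, hx⟩ hcon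
      simp only [hT]
      rw [Matrix.det_eq_zero_of_column_eq_zero j (fun i => by simp [hj, hw])]
      ring
  have h3 : ∀ p : Equiv.Perm (Fin m) × Equiv.Perm (Fin l), T (p.1.sumCongr p.2) = a y w := by
    rintro ⟨p, q⟩
    have hd : Matrix.det (Matrix.of fun (i j : Fin m) => (A (p j)).1 (Fin.castAdd k (α i)))
        = ((Equiv.Perm.sign p : ℤ) : ℝ) := by
      have : (Matrix.of fun (i j : Fin m) => (A (p j)).1 (Fin.castAdd k (α i)))
          = (1 : Matrix (Fin m) (Fin m) ℝ).submatrix id p := by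
        ext i j
        simp [hA, Matrix.one_apply]
      rw [this, Matrix.det_permute']
      simp
    have hq : a y (fun j => w (q j)) = ((Equiv.Perm.sign q : ℤ) : ℝ) * a y w := by
      have := (a y).map_perm w q
      rw [show (fun j => w (q j)) = w ∘ q from rfl, this, Units.smul_def, zsmul_eq_mul]
    simp only [hT, Equiv.Perm.sumCongr_apply, Sum.map_inl, Sum.map_inr, Sum.elim_inl, Sum.elim_inr,
      hd, hq, Equiv.Perm.sign_sumCongr]
    rcases Int.units_eq_one_or (Equiv.Perm.sign p) with hp | hp <;>
    rcases Int.units_eq_one_or (Equiv.Perm.sign q) with hq | hq <;> simp [hp, hq]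
  rw [h1, ← h2, Finset.sum_congr rfl (fun p _ => h3 p)]
  simp only [Finset.sum_const, Finset.card_univ, Fintype.card_prod, Fintype.card_perm,
    Fintype.card_fin, nsmul_eq_mul]
  rw [← mul_assoc, inv_mul_cancel₀, one_mul]
  exact_mod_cast (Nat.mul_pos m.factorial_pos l.factorial_pos).ne'

theorem extD_wedge_s17 {n k : ℕ} (l m : ℕ) (α : Fin m → Fin n)
    (a : Mfd n k → AlternatingMap ℝ (Mfd n k) ℝ (Fin l)) (y : Mfd n k)
    (A : Fin m → Mfd n k) (B : Fin (l + 1) → Mfd n k)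
    (hA : ∀ i j, (A j).1 (Fin.castAdd k (α i)) = if i = j then 1 else 0)
    (hB : ∀ i j, (B j).1 (Fin.castAdd k (α i)) = 0) :
    extD (wedgeDxA l m α a) y (Fin.append A B : Fin (m + (l + 1)) → Mfd n k)
      = (-1) ^ m * extD (fun y w => a y w) y B := by
  unfold extD
  have key : ∀ F : Fin (m + (l + 1)) → ℝ, ∑ i : Fin (m + l + 1), F i
      = ∑ i : Fin m, F (Fin.castAdd (l + 1) i) + ∑ i : Fin (l + 1), F (Fin.natAdd m i) :=
    fun F => Fin.sum_univ_add F
  refine (key _).trans ?_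
  rw [Finset.sum_eq_zero, zero_add, Finset.mul_sum]
  · refine Finset.sum_congr rfl fun i _ => ?_
    have hr : (Fin.removeNth (n := m + l) (Fin.natAdd m i : Fin (m + (l + 1)))
        (Fin.append A B : Fin (m + (l + 1)) → Mfd n k))
        = Fin.append A (Fin.removeNth i B) := by
      funext j
      rw [Fin.removeNth_apply]
      refine Fin.addCases (fun j => ?_) (fun j => ?_) j
      · have : Fin.succAbove (n := m + l) (Fin.natAdd m i : Fin (m + (l + 1))) (Fin.castAdd l j)
            = Fin.castAdd (l + 1) j := by
          ext
          simp only [Fin.succAbove, Fin.lt_def]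
          split_ifs with h
          · simp
          · simp at h; omega
        rw [this]; simp
      · have : Fin.succAbove (n := m + l) (Fin.natAdd m i : Fin (m + (l + 1))) (Fin.natAdd m j)
            = Fin.natAdd m (i.succAbove j) := by
          ext
          simp only [Fin.succAbove, Fin.lt_def]
          split_ifs with h h' h' <;> simp at h h' ⊢ <;> omega
        rw [this]; simp [Fin.removeNth_apply]
    have hf : (fun y' => wedgeDxA l m α a y' (Fin.removeNth (n := m + l)
        (Fin.natAdd m i : Fin (m + (l + 1)))
        (Fin.append A B : Fin (m + (l + 1)) → Mfd n k))) = fun y' => a y' (Fin.removeNth i B) := by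
      funext y'
      rw [hr]
      exact wedge_append l m α a y' A _ hA (fun i' j => by simp [Fin.removeNth_apply, hB])
    rw [hf, Fin.append_right, Fin.val_natAdd, pow_add]
    ring
  · intro i _
    have hf : (fun y' => wedgeDxA l m α a y' (Fin.removeNth (n := m + l)
        (Fin.castAdd (l + 1) i : Fin (m + (l + 1)))
        (Fin.append A B : Fin (m + (l + 1)) → Mfd n k))) = fun y' => 0 := by
      funext y'
      apply wedge_zero l m α a y' _ i
      intro j
      rw [Fin.removeNth_apply]
      have hne := Fin.succAbove_ne (n := m + l) (Fin.castAdd (l + 1) i : Fin (m + (l + 1))) j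
      revert hne
      generalize (Fin.succAbove (n := m + l) (Fin.castAdd (l + 1) i : Fin (m + (l + 1))) j) = q
      revert q
      intro (q : Fin (m + (l + 1)))
      refine Fin.addCases (fun q => ?_) (fun q => ?_) q
      · intro hne
        rw [Fin.append_left, hA, if_neg]
        rintro rfl
        exact hne rfl
      · intro _
        rw [Fin.append_right, hB]
    rw [hf]
    simp

/-- Moving the vector in the middle to the front. -/
theorem append_snoc_sign {M : Type*} [AddCommGroup M] [Module ℝ M] {n m p : ℕ}
    (hn : m + p = n) (h' : n + 1 = m + 1 + p) (G : AlternatingMap ℝ M ℝ (Fin (n + 1)))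
    (A : Fin m → M) (V : M) (B : Fin p → M) :
    G (fun j => (Fin.append (Fin.snoc A V) B : Fin (m + 1 + p) → M) (Fin.cast h' j))
      = (-1) ^ m * G (Fin.cons V (fun j => (Fin.append A B) (Fin.cast hn.symm j))) := by
  subst hn
  have : (fun j => (Fin.append (Fin.snoc A V) B : Fin (m + 1 + p) → M) (Fin.cast h' j))
      = Fin.insertNth (⟨m, by omega⟩ : Fin (m + p + 1)) V (Fin.append A B) := by
    rw [Fin.eq_insertNth_iff]
    constructor
    · have : Fin.cast h' (⟨m, by omega⟩ : Fin (m + p + 1)) = Fin.castAdd p (Fin.last m) := by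
        ext; simp
      rw [this]; simp
    · funext j
      rw [Fin.removeNth_apply]
      refine Fin.addCases (fun j => ?_) (fun j => ?_) j
      · have : Fin.cast h' (Fin.succAbove ⟨m, by omega⟩ (Fin.castAdd p j))
            = Fin.castAdd p (Fin.castSucc j) := by
          ext
          simp [Fin.succAbove, Fin.lt_def]
        rw [this]; simp
      · have : Fin.cast h' (Fin.succAbove ⟨m, by omega⟩ (Fin.natAdd m j))
            = Fin.natAdd (m + 1) j := by
          ext
          simp [Fin.succAbove, Fin.lt_def]; omega
        rw [this]; simp
  rw [this, AlternatingMap.map_insertNth, zsmul_eq_mul]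
  push_cast
  rfl

/-- Fix the first arguments of an alternating map. -/
def fixLeft {M : Type*} [AddCommGroup M] [Module ℝ M] {N q p : ℕ}
    (G : AlternatingMap ℝ M ℝ (Fin N)) (h' : N = q + p) (C : Fin q → M) :
    AlternatingMap ℝ M ℝ (Fin p) where
  toFun w := G (fun j => (Fin.append C w) (Fin.cast h' j))
  map_update_add' := by
    subst h'
    intro inst w i x y
    have : inst = instDecidableEqFin p := Subsingleton.elim _ _
    subst this
    have hu : ∀ z, Fin.append C (Function.update w i z)
        = Function.update (Fin.append C w) (Fin.natAdd q i) z := by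
      intro z
      funext j
      refine Fin.addCases (fun j => ?_) (fun j => ?_) j
      · rw [Function.update_of_ne]
        · simp
        · intro h; have := congrArg Fin.val h; simp at this; omega
      · by_cases hj : j = i
        · subst hj; simp
        · rw [Function.update_of_ne]
          · simp [hj]
          · intro h; apply hj; have := congrArg Fin.val h; simp at this; omega
    simp only [Fin.cast_eq_self, hu]
    exact G.map_update_add _ _ _ _
  map_update_smul' := by
    subst h'
    intro inst w i c x
    have : inst = instDecidableEqFin p := Subsingleton.elim _ _
    subst this
    have hu : ∀ z, Fin.append C (Function.update w i z)
        = Function.update (Fin.append C w) (Fin.natAdd q i) z := by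
      intro z
      funext j
      refine Fin.addCases (fun j => ?_) (fun j => ?_) j
      · rw [Function.update_of_ne]
        · simp
        · intro h; have := congrArg Fin.val h; simp at this; omega
      · by_cases hj : j = i
        · subst hj; simp
        · rw [Function.update_of_ne]
          · simp [hj]
          · intro h; apply hj; have := congrArg Fin.val h; simp at this; omega
    simp only [Fin.cast_eq_self, hu]
    exact G.map_update_smul _ _ _ _
  map_eq_zero_of_eq' := by
    subst h'
    intro w i j hw hij
    apply G.map_eq_zero_of_eq _ (i := Fin.natAdd q i) (j := Fin.natAdd q j)
    · simp [hw]
    · simpa using hij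

theorem graphMap_diff (la m k : ℕ)
    (u : (Fin (la + m + 1) → ℝ) → (Fin k → ℝ)) (hu : Differentiable ℝ u)
    (pm : (Fin (la + m + 1) → ℝ) → Psp (la + m + 1) k) (hpm : Differentiable ℝ pm) :
    Differentiable ℝ (graphMap la m k u pm) := by
  unfold graphMap
  refine Differentiable.prodMk ?_ hpm
  rw [differentiable_pi]
  intro i
  refine Fin.addCases (fun i => ?_) (fun i => ?_) i
  · simp only [Fin.append_left]; fun_prop
  · simp only [Fin.append_right]; fun_prop

theorem graphMap_fderiv_coord (la m k : ℕ)
    (u : (Fin (la + m + 1) → ℝ) → (Fin k → ℝ)) (hu : Differentiable ℝ u)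
    (pm : (Fin (la + m + 1) → ℝ) → Psp (la + m + 1) k) (hpm : Differentiable ℝ pm)
    (x v : Fin (la + m + 1) → ℝ) (i : Fin (la + m + 1)) :
    (fderiv ℝ (graphMap la m k u pm) x v).1 (Fin.castAdd k i) = v i := by
  let P : Mfd (la + m + 1) k →L[ℝ] ℝ :=
    (ContinuousLinearMap.proj (R := ℝ) (φ := fun _ : Fin (la + m + 1 + k) => ℝ)
      (Fin.castAdd k i)).comp (ContinuousLinearMap.fst ℝ _ _)
  have h1 : HasFDerivAt (fun z => P (graphMap la m k u pm z))
      (P.comp (fderiv ℝ (graphMap la m k u pm) x)) x :=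
    P.hasFDerivAt.comp x (graphMap_diff la m k u hu pm hpm x).hasFDerivAt
  have h2 : (fun z => P (graphMap la m k u pm z))
      = fun z => ContinuousLinearMap.proj (R := ℝ) (φ := fun _ : Fin (la + m + 1) => ℝ) i z := by
    funext z
    simp [P, graphMap]
  rw [h2] at h1
  have h3 := h1.unique (ContinuousLinearMap.hasFDerivAt _)
  have h4 := DFunLike.congr_fun h3 v
  simpa [P] using h4

/-- Given an injective `β`, exactly one increasing multi-index is complementary to it. -/
theorem exists_compl (la m : ℕ) (β : Fin (la + 1) → Fin (la + m + 1))
    (hβ : Function.Injective β) :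
    ∃ α₀ : {α : Fin m → Fin (la + m + 1) // IncP α},
      (∀ i j, α₀.1 i ≠ β j) ∧
      ∀ α : {α : Fin m → Fin (la + m + 1) // IncP α}, (∀ i j, α.1 i ≠ β j) → α = α₀ := by
  classical
  set s : Finset (Fin (la + m + 1)) := (Finset.univ.image β)ᶜ with hs
  have hc : s.card = m := by
    rw [hs, Finset.card_compl, Finset.card_image_of_injective _ hβ]
    simp
  refine ⟨⟨s.orderEmbOfFin hc, fun a b h => (s.orderEmbOfFin hc).strictMono h⟩, ?_, ?_⟩
  · intro i j h
    have := s.orderEmbOfFin_mem hc i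
    rw [show s.orderEmbOfFin hc i = β j from h] at this
    refine (Finset.mem_compl.mp this) ?_
    exact Finset.mem_image.mpr ⟨j, Finset.mem_univ _, rfl⟩
  · intro α h
    apply Subtype.ext
    refine Finset.orderEmbOfFin_unique hc ?_ (fun a b hab => α.2 a b hab)
    intro i
    simp only [hs, Finset.mem_compl, Finset.mem_image, Finset.mem_univ, true_and, not_exists]
    exact fun j hj => h i j hj.symm

/-- (Theorem 3.) Let `H` be a smooth Hamiltonian and `Γ` the graph of a solution
`x ↦ U(x) = (x,u(x),p(x))` of the Hamilton equations
`(∂U/∂x¹∧…∧∂U/∂xⁿ)⌟Ω = (∂U/∂x¹∧…∧∂U/∂xⁿ)⌟(dH∧ω)`. Then for every `a ∈ 𝔓^{p-1}M`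
and every oriented `p`-dimensional piece `D ⊆ Γ`:
`∫_D da = ∫_{D_Γ} {Hω, ˢa}_s`, the right-hand side being
`−∫_D Σ_{α₁<…<α_{n-p}} (X_{α₁}∧…∧X_{α_{n-p}}∧Ξ(dx^{α₁}∧…∧dx^{α_{n-p}}∧a)) ⌟ d(Hω)`. -/
theorem integral_dynamics_of_low_degree_observables
    (la m k : ℕ)
    (H : Mfd (la + m + 1) k → ℝ) (hH : ContDiff ℝ (⊤ : ℕ∞) H)
    (u : (Fin (la + m + 1) → ℝ) → (Fin k → ℝ)) (hu : ContDiff ℝ (⊤ : ℕ∞) u)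
    (pm : (Fin (la + m + 1) → ℝ) → Psp (la + m + 1) k) (hpm : ContDiff ℝ (⊤ : ℕ∞) pm)
    (hHam : ∀ (x : Fin (la + m + 1) → ℝ) (V : Mfd (la + m + 1) k),
      Omega (la + m + 1) k (graphMap la m k u pm x)
          (Fin.snoc (frame la m k (graphMap la m k u pm) x) V)
        = dHomega la m k H (graphMap la m k u pm x)
            (Fin.snoc (frame la m k (graphMap la m k u pm) x) V))
    (a : Mfd (la + m + 1) k → AlternatingMap ℝ (Mfd (la + m + 1) k) ℝ (Fin la))
    (ha : ∀ v, ContDiff ℝ (⊤ : ℕ∞) (fun x => a x v))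
    (XiA : (Fin m → Fin (la + m + 1)) → Mfd (la + m + 1) k → Mfd (la + m + 1) k)
    (hXiA : ∀ α : Fin m → Fin (la + m + 1), IncP α →
      ∀ (x : Mfd (la + m + 1) k) (v : Fin (la + m + 1) → Mfd (la + m + 1) k),
        extD (wedgeDxA la m α a) x (fun j => v (Fin.cast (by omega) j))
          = - iota (XiA α) (Omega (la + m + 1) k) x v)
    -- the `p`-dimensional piece `D ⊆ Γ`, parametrized over `Δ`:
    (Δ : Set (Fin (la + 1) → ℝ)) (hΔ : MeasurableSet Δ)
    (hΔb : Bornology.IsBounded Δ)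
    (xmap : (Fin (la + 1) → ℝ) → (Fin (la + m + 1) → ℝ)) (hx : ContDiff ℝ (⊤ : ℕ∞) xmap) :
    (∫ t in Δ,
      extD (fun y w => a y w) (graphMap la m k u pm (xmap t))
        (fun j : Fin (la + 1) =>
          fderiv ℝ (fun s => graphMap la m k u pm (xmap s)) t (Pi.single j 1)))
    =
    (∫ t in Δ,
      - ∑ α : {α : Fin m → Fin (la + m + 1) // IncP α},
          extD (fun y w => H y * vol (la + m + 1) k y w)
            (graphMap la m k u pm (xmap t))
            (fun j : Fin (la + m + 2) =>
              (Fin.append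
                (Fin.snoc
                  (fun i : Fin m =>
                    frame la m k (graphMap la m k u pm) (xmap t) (α.1 i))
                  (XiA α.1 (graphMap la m k u pm (xmap t))))
                (fun j' : Fin (la + 1) =>
                  fderiv ℝ (fun s => graphMap la m k u pm (xmap s)) t
                    (Pi.single j' 1)) : Fin (m + 1 + (la + 1)) → Mfd (la + m + 1) k)
                (Fin.cast (by omega) j))) := by
  have hH' : Differentiable ℝ H := hH.differentiable (by simp)
  have hu' : Differentiable ℝ u := hu.differentiable (by simp)
  have hpm' : Differentiable ℝ pm := hpm.differentiable (by simp)
  have ha' : ∀ v, Differentiable ℝ (fun x => a x v) := fun v => (ha v).differentiable (by simp)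
  have hx' : Differentiable ℝ xmap := hx.differentiable (by simp)
  have hg := graphMap_diff la m k u hu' pm hpm'
  congr 1
  funext t
  set x := xmap t with hxt
  set y := graphMap la m k u pm x with hy
  set L := fderiv ℝ (graphMap la m k u pm) x with hL
  have hT : ∀ j : Fin (la + 1), fderiv ℝ (fun s => graphMap la m k u pm (xmap s)) t (Pi.single j 1)
      = L (fderiv ℝ xmap t (Pi.single j 1)) := by
    intro j
    have h1 : HasFDerivAt (fun s => graphMap la m k u pm (xmap s)) (L.comp (fderiv ℝ xmap t)) t :=
      (hg x).hasFDerivAt.comp t (hx' t).hasFDerivAt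
    rw [h1.fderiv]; rfl
  simp only [hT]
  set X := frame la m k (graphMap la m k u pm) x with hX
  have hXL : ∀ i, X i = L (Pi.single i 1) := fun i => rfl
  have hdx : ∀ i j, (X j).1 (Fin.castAdd k i) = if i = j then (1 : ℝ) else 0 := by
    intro i j
    rw [hXL, hL, graphMap_fderiv_coord la m k u hu' pm hpm', Pi.single_apply]
  set G := extAlt (HvolAlt H) (HvolAlt_diff H hH') y with hG
  set O := extAlt (thetaAlt (la + m + 1) k) (thetaAlt_diff (la + m + 1) k) y with hO
  have hagree : ∀ V, O (Fin.snoc X V) = G (Fin.snoc X V) := by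
    intro V
    have := hHam x V
    rw [Omega_eq, dHomega_eq la m k H hH'] at this
    exact this
  have hcast : la + m + 1 + 1 = m + 1 + (la + 1) := by omega
  have hmain : (extAlt a ha' y).compLinearMap (L : (Fin (la + m + 1) → ℝ) →ₗ[ℝ] Mfd (la + m + 1) k)
      = - ∑ α : {α : Fin m → Fin (la + m + 1) // IncP α},
        (fixLeft G hcast (Fin.snoc (fun i => X (α.1 i)) (XiA α.1 y))).compLinearMap
          (L : (Fin (la + m + 1) → ℝ) →ₗ[ℝ] Mfd (la + m + 1) k) := by
    refine Module.Basis.ext_alternating (Pi.basisFun ℝ (Fin (la + m + 1))) fun β hβ => ?_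
    rw [AlternatingMap.neg_apply, sumAlt_apply]
    simp only [AlternatingMap.compLinearMap_apply, Pi.basisFun_apply,
      ContinuousLinearMap.coe_coe, ← hXL]
    have happ : ∀ (α : Fin m → Fin (la + m + 1)) (q : Fin (m + (la + 1))),
        Fin.append (fun i => X (α i)) (fun i => X (β i)) q = X (Fin.append α β q) := by
      intro α q
      refine Fin.addCases (fun q => ?_) (fun q => ?_) q <;> simp
    have hval : ∀ α : {α : Fin m → Fin (la + m + 1) // IncP α},
        fixLeft G hcast (Fin.snoc (fun i => X (α.1 i)) (XiA α.1 y)) (fun i => X (β i))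
          = (-1) ^ m * G (Fin.cons (XiA α.1 y)
            (X ∘ fun j : Fin (la + m + 1) =>
            Fin.append α.1 β (Fin.cast (by omega) j))) := by
      intro α
      refine (append_snoc_sign (n := la + m + 1) (by omega) hcast G _ _ _).trans ?_
      congr 3
      funext j
      rw [Function.comp_apply, ← happ α.1]
    have hzero : ∀ α : {α : Fin m → Fin (la + m + 1) // IncP α}, (¬ ∀ i j, α.1 i ≠ β j) →
        fixLeft G hcast (Fin.snoc (fun i => X (α.1 i)) (XiA α.1 y)) (fun i => X (β i)) = 0 := by
      intro α hα
      push Not at hα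
      obtain ⟨i, j, hij⟩ := hα
      rw [hval]
      have hne : Fin.castAdd (la + 1) i ≠ Fin.natAdd m j := by
        intro h
        have := congrArg Fin.val h
        simp at this
        omega
      have hc2 : m + (la + 1) = la + m + 1 := by omega
      rw [G.map_eq_zero_of_eq _ (i := (Fin.cast hc2 (Fin.castAdd (la + 1) i)).succ)
        (j := (Fin.cast hc2 (Fin.natAdd m j)).succ), mul_zero]
      · simp only [Fin.cons_succ, Function.comp_apply, Fin.cast_cast, Fin.cast_eq_self,
          Fin.append_left, Fin.append_right, hij]
      · intro h
        exact hne (Fin.cast_injective hc2 (Fin.succ_injective _ h))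
    have hgood : ∀ α : {α : Fin m → Fin (la + m + 1) // IncP α}, (∀ i j, α.1 i ≠ β j) →
        fixLeft G hcast (Fin.snoc (fun i => X (α.1 i)) (XiA α.1 y)) (fun i => X (β i))
          = - extAlt a ha' y (fun i => X (β i)) := by
      intro α hα
      have hinj : Function.Injective α.1 :=
        StrictMono.injective (fun a b hab => α.2 a b hab)
      have hw := extD_wedge_s17 la m α.1 a y (fun i => X (α.1 i)) (fun i => X (β i))
        (fun i j => by rw [hdx]; simp [hinj.eq_iff])
        (fun i j => by rw [hdx, if_neg (hα i j)])
      have hxi := hXiA α.1 α.2 y (X ∘ fun j : Fin (la + m + 1) =>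
            Fin.append α.1 β (Fin.cast (by omega) j))
      have hv : (fun j : Fin (m + la + 1) =>
          (X ∘ fun j : Fin (la + m + 1) =>
            Fin.append α.1 β (Fin.cast (by omega) j)) (Fin.cast (by omega) j))
          = (Fin.append (fun i => X (α.1 i)) (fun i => X (β i)) :
            Fin (m + (la + 1)) → Mfd (la + m + 1) k) := by
        funext j
        exact (happ α.1 j).symm
      rw [hv, hw, iota, Omega_eq, agree_cons _ _ X hagree, extAlt_apply a ha'] at hxi
      rw [hval, ← neg_eq_iff_eq_neg.mpr hxi, ← neg_mul_eq_mul_neg, neg_inj, ← mul_assoc,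
        ← pow_add, Even.neg_one_pow ⟨m, rfl⟩, one_mul]
    obtain ⟨α₀, h0, huniq⟩ := exists_compl la m β hβ
    rw [Finset.sum_eq_single α₀, hgood α₀ h0, neg_neg]
    · intro α _ hne
      exact hzero α fun h => hne (huniq α h)
    · intro h
      exact absurd (Finset.mem_univ _) h
  have hfin := DFunLike.congr_fun hmain (fun j => fderiv ℝ xmap t (Pi.single j 1))
  rw [AlternatingMap.neg_apply, sumAlt_apply] at hfin
  rw [extAlt_apply a ha']
  refine hfin.trans ?_
  congr 1
  refine Finset.sum_congr rfl fun α _ => ?_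
  rw [extD_Hvol_eq H hH']
  rfl

end Pataplectic

end
end
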